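/- (Lemma 4.1.) For every compact open subgroup K₀ of G there exists a compact subset Ω of Ū_♦ such that for every continuous function W : G → ℂ satisfying W(v·g) = ψ_N(v)·W(g) for all v ∈ N, g ∈ G, and W(g·k) = W(g) for all g ∈ G, k ∈ K₀, one has {u ∈ Ū_♦ : W(u) ≠ 0} ⊆ Ω. (In particular, the bound on the support is uniform over all such W.) -/

import Mathlib

open scoped MatrixGroups
open Matrix

/-- The `k × k` antidiagonal matrix `w_k` (ones on the antidiagonal, zeros elsewhere). -/
noncomputable def wa (p : ℕ) [Fact p.Prime] (k : ℕ) : Matrix (Fin k) (Fin k) ℚ_[p] :=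
  Matrix.of fun i j => if (i : ℕ) + (j : ℕ) = k - 1 then 1 else 0

/-- Identification of `Fin k ⊕ Fin k` with `Fin (2 * k)`. -/
def sumEquiv (k : ℕ) : (Fin k ⊕ Fin k) ≃ Fin (2 * k) :=
  finSumFinEquiv.trans (finCongr (by omega))

/-- The `2k × 2k` matrix built from four `k × k` blocks. -/
noncomputable def blk (p : ℕ) [Fact p.Prime] {k : ℕ} (A B C D : Matrix (Fin k) (Fin k) ℚ_[p]) :
    Matrix (Fin (2 * k)) (Fin (2 * k)) ℚ_[p] :=
  Matrix.reindex (sumEquiv k) (sumEquiv k) (Matrix.fromBlocks A B C D)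

/-- The symplectic form matrix `J = [[0, w_{2n}], [-w_{2n}, 0]]` of size `4n`. -/
noncomputable def Jmat (p : ℕ) [Fact p.Prime] (n : ℕ) :
    Matrix (Fin (2 * (2 * n))) (Fin (2 * (2 * n))) ℚ_[p] :=
  blk p 0 (wa p (2 * n)) (-(wa p (2 * n))) 0

/-- The group `G = {g ∈ GL_{4n}(ℚ_p) : gᵀ J g = J}`, as a subset of `GL_{4n}(ℚ_p)`. -/
def SpSet (p : ℕ) [Fact p.Prime] (n : ℕ) : Set (GL (Fin (2 * (2 * n))) ℚ_[p]) :=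
  {g | (g : Matrix (Fin (2 * (2 * n))) (Fin (2 * (2 * n))) ℚ_[p])ᵀ * Jmat p n * g = Jmat p n}

/-- `g` is upper triangular with all diagonal entries equal to `1`. -/
def IsUnipUpper {R : Type*} [Zero R] [One R] {m : ℕ} (g : Matrix (Fin m) (Fin m) R) : Prop :=
  (∀ i j : Fin m, (j : ℕ) < (i : ℕ) → g i j = 0) ∧ ∀ i : Fin m, g i i = 1

/-- The sum `g_{1,2} + g_{2,3} + ⋯ + g_{k,k+1}` of the first `k` superdiagonal entries of `g`
(1-based indexing); the argument of `ψ` in the character `ψ_N`. -/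
noncomputable def sdSumUpTo {R : Type*} [AddCommMonoid R] (m k : ℕ)
    (g : Matrix (Fin m) (Fin m) R) : R :=
  ∑ i : Fin k, if h : (i : ℕ) + 1 < m then g ⟨(i : ℕ), by omega⟩ ⟨(i : ℕ) + 1, h⟩ else 0

/-- The matrix `[[I_{2n}, 0], [z, I_{2n}]]` with `z = [[x*, y], [0, x]]`,
where `x* = wₙ xᵀ wₙ`. -/
noncomputable def ubarMat (p : ℕ) [Fact p.Prime] {n : ℕ} (x y : Matrix (Fin n) (Fin n) ℚ_[p]) :
    Matrix (Fin (2 * (2 * n))) (Fin (2 * (2 * n))) ℚ_[p] :=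
  blk p 1 0 (blk p (wa p n * xᵀ * wa p n) y 0 x) 1

/-- The subgroup `Ū_♦` of `G`: matrices `[[I, 0], [z, I]]` with `z = [[x*, y], [0, x]]`,
`x` having first column zero and `y` satisfying `wₙ yᵀ wₙ = y`. -/
def UbarSet (p : ℕ) [Fact p.Prime] (n : ℕ) : Set (GL (Fin (2 * (2 * n))) ℚ_[p]) :=
  {u | ∃ x y : Matrix (Fin n) (Fin n) ℚ_[p],
    (∀ i j : Fin n, (j : ℕ) = 0 → x i j = 0) ∧ wa p n * yᵀ * wa p n = y ∧
    (u : Matrix (Fin (2 * (2 * n))) (Fin (2 * (2 * n))) ℚ_[p]) = ubarMat p x y}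

section Ultrametric

variable {K : Type*} [NormedField K] [IsUltrametricDist K] {ι κ μ : Type*} [Fintype ι]
  [Fintype κ]

omit [Fintype ι] [Fintype κ] in
lemma norm_sub_le_of_le_of_le {x y : K} {c : ℝ} (hx : ‖x‖ ≤ c) (hy : ‖y‖ ≤ c) : ‖x - y‖ ≤ c := by
  rw [sub_eq_add_neg]
  exact (IsUltrametricDist.norm_add_le_max _ _).trans (max_le hx (by rwa [norm_neg]))

omit [Fintype κ] in
lemma norm_mul_apply_le {A : Matrix μ ι K} {B : Matrix ι κ K} {a b : ℝ} (ha : 0 ≤ a) (hb : 0 ≤ b)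
    {i : μ} {j : κ} (hA : ∀ k, ‖A i k‖ ≤ a) (hB : ∀ k, ‖B k j‖ ≤ b) : ‖(A * B) i j‖ ≤ a * b := by
  rw [Matrix.mul_apply]
  refine IsUltrametricDist.norm_sum_le_of_forall_le_of_nonneg (by positivity) fun k _ => ?_
  rw [norm_mul]
  exact mul_le_mul (hA k) (hB k) (norm_nonneg _) ha

omit [IsUltrametricDist K] [Fintype ι] [Fintype κ] in
lemma norm_one_matrix_apply_le [DecidableEq μ] (i j : μ) : ‖(1 : Matrix μ μ K) i j‖ ≤ 1 := by
  rw [Matrix.one_apply]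
  split_ifs <;> simp

lemma norm_det_le_prod [DecidableEq ι] (A : Matrix ι ι K) (β : ι → ℝ)
    (h : ∀ i j, ‖A i j‖ ≤ β i) : ‖A.det‖ ≤ ∏ i, β i := by
  rw [← Matrix.det_transpose, Matrix.det_apply]
  have hβ : ∀ i, 0 ≤ β i := fun i => (norm_nonneg _).trans (h i i)
  refine IsUltrametricDist.norm_sum_le_of_forall_le_of_nonneg
    (Finset.prod_nonneg fun i _ => hβ i) fun σ _ => ?_
  have h1 : ‖Equiv.Perm.sign σ • ∏ i, (Aᵀ) (σ i) i‖ = ‖∏ i, (Aᵀ) (σ i) i‖ := by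
    rcases Int.units_eq_one_or (Equiv.Perm.sign σ) with h | h <;> simp [h]
  rw [h1, norm_prod]
  exact Finset.prod_le_prod (fun i _ => norm_nonneg _) fun i _ => h i _

lemma norm_det_le_one [DecidableEq ι] (A : Matrix ι ι K) (h : ∀ i j, ‖A i j‖ ≤ 1) :
    ‖A.det‖ ≤ 1 := by
  simpa using norm_det_le_prod A (fun _ => 1) h

lemma norm_adjugate_apply_le [DecidableEq ι] (A : Matrix ι ι K) {B : ℝ} (hB : 1 ≤ B)
    (h : ∀ i j, ‖A i j‖ ≤ B) (i j : ι) : ‖A.adjugate i j‖ ≤ B ^ Fintype.card ι := by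
  rw [Matrix.adjugate_apply]
  refine (norm_det_le_prod _ (fun _ => B) fun k l => ?_).trans (by simp)
  rw [Matrix.updateRow_apply]
  split_ifs
  · rw [Pi.single_apply]
    split_ifs
    · simpa using hB
    · simpa using zero_le_one.trans hB
  · exact h k l

/-- Nonarchimedean Iwasawa decomposition of a matrix with a right inverse: up to an upper
triangular unipotent and a diagonal factor, it is integral with an integral right inverse. -/
lemma exists_iwasawa [DecidableEq κ] {m : ℕ} (R : Matrix (Fin m) κ K) (S : Matrix κ (Fin m) K)
    (hRS : R * S = 1) :
    ∃ (u : Matrix (Fin m) (Fin m) K) (b : Fin m → K) (Q : Matrix (Fin m) κ K)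
      (P : Matrix κ (Fin m) K), IsUnipUpper u ∧ (∀ i, b i ≠ 0) ∧ (∀ i j, ‖Q i j‖ ≤ 1) ∧
      (∀ i j, ‖P i j‖ ≤ 1) ∧ u * R = Matrix.diagonal b * Q ∧ Q * P = 1 := by
  induction m with
  | zero =>
    exact ⟨1, fun i => i.elim0, R, S, ⟨fun i => i.elim0, fun i => i.elim0⟩, fun i => i.elim0,
      fun i => i.elim0, fun _ i => i.elim0, by ext i; exact i.elim0, hRS⟩
  | succ m ih =>
    have hRS' : ∀ i j, ∑ k, R i k * S k j = (1 : Matrix (Fin (m + 1)) (Fin (m + 1)) K) i j :=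
      fun i j => by rw [← hRS, Matrix.mul_apply]
    obtain ⟨u, b, Q, P, hu, hb, hQ, hP, huR, hQP⟩ := ih (R.submatrix Fin.succ id)
      (S.submatrix id Fin.succ) (by
        ext i j
        simp [Matrix.mul_apply, hRS', Matrix.one_apply])
    set r : κ → K := R 0 with hr
    set a : Fin m → K := r ᵥ* P with ha
    set d : κ → K := r - a ᵥ* Q with hd
    set t : Fin m → K := (fun i => -(a i * (b i)⁻¹)) ᵥ* u with ht
    have hQ' : Q = Matrix.diagonal (fun i => (b i)⁻¹) * (u * R.submatrix Fin.succ id) := by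
      rw [huR, ← Matrix.mul_assoc, Matrix.diagonal_mul_diagonal]
      simp [hb]
    have htR : r + t ᵥ* R.submatrix Fin.succ id = d := by
      have : a ᵥ* Q = -(t ᵥ* R.submatrix Fin.succ id) := by
        rw [hQ', ht, ← Matrix.vecMul_vecMul, ← Matrix.vecMul_vecMul, ← Matrix.neg_vecMul,
          ← Matrix.neg_vecMul]
        congr 2
        ext i
        simp [Matrix.vecMul_diagonal]
      rw [hd, this, sub_neg_eq_add]
    have hdP : d ᵥ* P = 0 := by
      rw [hd, Matrix.sub_vecMul, Matrix.vecMul_vecMul, hQP, Matrix.vecMul_one, ← ha, sub_self]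
    have hd1 : ∑ k, d k * S k 0 = 1 := by
      rw [← htR]
      have h2 : ∀ i : Fin m, ∑ k, R i.succ k * S k 0 = 0 := fun i => by
        rw [hRS']; simp
      calc ∑ k, (r + t ᵥ* R.submatrix Fin.succ id) k * S k 0
          = ∑ k, r k * S k 0 + ((t ᵥ* R.submatrix Fin.succ id) ⬝ᵥ fun k => S k 0) := by
            simp [add_mul, Finset.sum_add_distrib, dotProduct]
        _ = 1 + t ⬝ᵥ (R.submatrix Fin.succ id *ᵥ fun k => S k 0) := by
            rw [hr, hRS', Matrix.dotProduct_mulVec]; simp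
        _ = 1 := by
            have : (R.submatrix Fin.succ id *ᵥ fun k => S k 0) = 0 := by
              ext i
              simpa [Matrix.mulVec, dotProduct] using h2 i
            rw [this]; simp
    obtain ⟨k₀, -, hk₀⟩ : ∃ k ∈ (Finset.univ : Finset κ), d k * S k 0 ≠ 0 :=
      Finset.exists_ne_zero_of_sum_ne_zero (by rw [hd1]; exact one_ne_zero)
    obtain ⟨π, -, hπ⟩ :=
      Finset.exists_max_image Finset.univ (fun k => ‖d k‖) ⟨k₀, Finset.mem_univ _⟩
    have hdπ : d π ≠ 0 := by
      have h3 := hπ k₀ (Finset.mem_univ _)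
      have h4 : 0 < ‖d k₀‖ := norm_pos_iff.2 (left_ne_zero_of_mul hk₀)
      exact norm_pos_iff.1 (h4.trans_le h3)
    have hPQ : ∀ k, ‖(P * Q) k π‖ ≤ 1 := fun k => by
      simpa using norm_mul_apply_le zero_le_one zero_le_one (hP k) (fun i => hQ i π)
    have hQPij : ∀ i j, ∑ k, Q i k * P k j = (1 : Matrix (Fin m) (Fin m) K) i j :=
      fun i j => by rw [← hQP, Matrix.mul_apply]
    have hdPj : ∀ j, ∑ k, d k * P k j = 0 := fun j => congrFun hdP j
    refine ⟨Matrix.of (Fin.cons (Fin.cons 1 t) fun i => Fin.cons 0 (u i)), Fin.cons (d π) b,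
      Matrix.of (Fin.cons (fun k => (d π)⁻¹ * d k) fun i => Q i),
      Matrix.of fun k => Fin.cons ((1 : Matrix κ κ K) k π - (P * Q) k π) (P k),
      ⟨?_, ?_⟩, ?_, ?_, ?_, ?_, ?_⟩
    · intro i j hij
      refine Fin.cases (fun h => absurd h (by simp)) (fun i h => ?_) i hij
      revert h
      refine Fin.cases (fun _ => by simp) (fun j h => ?_) j
      simpa using hu.1 i j (by simpa using h)
    · intro i
      refine Fin.cases (by simp) (fun i => by simpa using hu.2 i) i
    · intro i
      refine Fin.cases (by simpa using hdπ) (fun i => by simpa using hb i) i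
    · intro i j
      refine Fin.cases ?_ (fun i => by simpa using hQ i j) i
      simp only [of_apply, Fin.cons_zero, norm_mul, norm_inv]
      rw [inv_mul_le_iff₀ (norm_pos_iff.2 hdπ), mul_one]
      exact hπ j (Finset.mem_univ _)
    · intro k j
      refine Fin.cases ?_ (fun j => by simpa using hP k j) j
      simp only [of_apply, Fin.cons_zero]
      refine norm_sub_le_of_le_of_le ?_ (hPQ k)
      exact norm_one_matrix_apply_le k π
    · ext i k
      refine Fin.cases ?_ (fun i => ?_) i
      · have := congrFun htR k
        simp only [Pi.add_apply, Matrix.vecMul, dotProduct, submatrix_apply, id] at this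
        simp only [Matrix.mul_apply, Fin.sum_univ_succ, of_apply, Fin.cons_zero, Fin.cons_succ,
          Matrix.diagonal_apply]
        simp [← this, hdπ, hr, (Fin.succ_ne_zero _).symm]
      · have := congrFun (congrFun huR i) k
        simp only [Matrix.mul_apply, submatrix_apply, id] at this
        simp [Matrix.mul_apply, Fin.sum_univ_succ, Matrix.diagonal_apply, this]
    · have h5 : ∀ v : κ → K, ∑ k, v k * ((1 : Matrix κ κ K) k π - (P * Q) k π)
          = v π - ∑ j, (∑ k, v k * P k j) * Q j π := fun v => by
        simp only [mul_sub, Finset.sum_sub_distrib, Matrix.mul_apply, Finset.sum_mul,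
          Finset.mul_sum]
        rw [Finset.sum_comm (s := (Finset.univ : Finset (Fin m)))]
        simp [Matrix.one_apply, mul_assoc]
      ext i j
      refine Fin.cases (Fin.cases ?_ (fun j => ?_) j) (fun i => Fin.cases ?_ (fun j => ?_) j) i
      · simp only [Matrix.mul_apply, of_apply, Fin.cons_zero, mul_assoc]
        rw [← Finset.mul_sum]
        simp only [← Matrix.mul_apply]
        rw [h5]
        simp [hdPj, hdπ]
      · simp only [Matrix.mul_apply, of_apply, Fin.cons_zero, Fin.cons_succ, mul_assoc]
        rw [← Finset.mul_sum, hdPj]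
        simp [eq_comm]
      · simp only [Matrix.mul_apply, of_apply, Fin.cons_zero, Fin.cons_succ]
        simp only [← Matrix.mul_apply]
        rw [h5]
        simp [hQPij, Matrix.one_apply]
      · simp only [Matrix.mul_apply, of_apply, Fin.cons_succ]
        rw [hQPij]
        simp [Matrix.one_apply]

omit [IsUltrametricDist K] [Fintype ι] [Fintype κ] in
lemma isCompact_setOf_norm_apply_le [ProperSpace K] (r : ℝ) :
    IsCompact {C : Matrix ι κ K | ∀ i j, ‖C i j‖ ≤ r} := by
  have h : IsCompact
      (Set.univ.pi fun _ : ι => Set.univ.pi fun _ : κ => Metric.closedBall (0 : K) r) :=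
    isCompact_univ_pi fun _ => isCompact_univ_pi fun _ => isCompact_closedBall _ _
  change IsCompact (X := ι → κ → K) {C | ∀ i j, ‖C i j‖ ≤ r}
  convert h using 1
  ext C
  simp [Set.mem_pi]

/-- Among the matrices `x * A + B` with `A`, `B` integral, the largest determinant is attained
by some `1 + x * C`. -/
lemma exists_norm_det_le_norm_det_one_add_mul [ProperSpace K] [DecidableEq ι]
    (x : Matrix ι ι K) :
    ∃ C : Matrix ι ι K, (∀ i j, ‖C i j‖ ≤ 1) ∧ ∀ A B : Matrix ι ι K, (∀ i j, ‖A i j‖ ≤ 1) →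
      (∀ i j, ‖B i j‖ ≤ 1) → ‖(x * A + B).det‖ ≤ ‖(1 + x * C).det‖ := by
  obtain ⟨C, hC, hmax⟩ :=
    (isCompact_setOf_norm_apply_le (K := K) (ι := ι) (κ := ι) 1).exists_isMaxOn ⟨0, by simp⟩
      (f := fun C : Matrix ι ι K => ‖(1 + x * C).det‖) (by fun_prop)
  refine ⟨C, hC, fun A B hA hB => ?_⟩
  set T := 1 + x * C with hT
  have hdet : 1 ≤ ‖T.det‖ := by
    have := hmax (show (0 : Matrix ι ι K) ∈ _ by simp)
    simpa using this
  have hdet0 : T.det ≠ 0 := norm_pos_iff.1 (zero_lt_one.trans_le hdet)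
  have hTinv : T * T⁻¹ = 1 := Matrix.mul_nonsing_inv T (isUnit_iff_ne_zero.2 hdet0)
  have hTinv' : T⁻¹ * T = 1 := Matrix.nonsing_inv_mul T (isUnit_iff_ne_zero.2 hdet0)
  have hle : ∀ C' : Matrix ι ι K, (∀ i j, ‖C' i j‖ ≤ 1) → ‖(1 + (T⁻¹ * x) * C').det‖ ≤ 1 := by
    intro C' hC'
    have h1 : ‖(1 + x * (C + C')).det‖ ≤ ‖T.det‖ := hmax (show C + C' ∈ _ from fun i j =>
      (IsUltrametricDist.norm_add_le_max _ _).trans (max_le (hC i j) (hC' i j)))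
    have h2 : 1 + x * (C + C') = T * (1 + (T⁻¹ * x) * C') := by
      rw [mul_add T, mul_one, ← mul_assoc, ← mul_assoc, hTinv, one_mul, mul_add, hT, add_assoc]
    rw [h2, Matrix.det_mul, norm_mul] at h1
    exact (mul_le_iff_le_one_right (zero_lt_one.trans_le hdet)).1 h1
  have hX : ∀ i j, ‖(T⁻¹ * x) i j‖ ≤ 1 := by
    intro i j
    have h1 := hle (vecMulVec (Pi.single j 1) (Pi.single i 1)) (fun k l => by
      simp only [vecMulVec_apply, Pi.single_apply]
      split_ifs <;> simp)
    rw [Matrix.mul_vecMulVec, Matrix.vecMulVec_eq Unit,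
      Matrix.det_one_add_replicateCol_mul_replicateRow] at h1
    simp only [mulVec_single_one, single_one_dotProduct, Matrix.col_apply] at h1
    calc ‖(T⁻¹ * x) i j‖ = ‖(1 + (T⁻¹ * x) i j) - 1‖ := by congr 1; ring
      _ ≤ 1 := norm_sub_le_of_le_of_le h1 (by simp)
  have hTi : ∀ i j, ‖T⁻¹ i j‖ ≤ 1 := by
    have h1 : T⁻¹ = 1 - (T⁻¹ * x) * C := by
      rw [eq_sub_iff_add_eq]
      conv_rhs => rw [← hTinv', hT, mul_add, mul_one, ← mul_assoc]
    intro i j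
    rw [h1]
    refine norm_sub_le_of_le_of_le (norm_one_matrix_apply_le i j) ?_
    simpa using norm_mul_apply_le zero_le_one zero_le_one (hX i) (fun k => hC k j)
  have h3 : x * A + B = T * (T⁻¹ * x * A + T⁻¹ * B) := by
    rw [mul_add, ← mul_assoc, ← mul_assoc, ← mul_assoc, hTinv, one_mul, one_mul]
  rw [h3, Matrix.det_mul, norm_mul]
  refine mul_le_of_le_one_right (norm_nonneg _) (norm_det_le_one _ fun i j => ?_)
  refine (IsUltrametricDist.norm_add_le_max _ _).trans (max_le ?_ ?_)
  · simpa using norm_mul_apply_le zero_le_one zero_le_one (hX i) (fun k => hA k j)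
  · simpa using norm_mul_apply_le zero_le_one zero_le_one (hTi i) (fun k => hB k j)

end Ultrametric

lemma le_of_prod_le_prod_ite {ι : Type*} [Fintype ι] [DecidableEq ι] {f g : ι → ℝ} {D : ℝ} (l : ι)
    (hD : 1 ≤ D) (hf : ∀ i, 1 ≤ f i) (hg : ∀ i, 1 ≤ g i) (hfg : ∀ i j, f i ≤ D * g j)
    (h : ∏ i, g i ≤ ∏ i, if i = l then 1 else f i) (i : ι) :
    f i ≤ (D ^ (Fintype.card ι + 1)) ^ (Fintype.card ι + 1) ∧
      g i ≤ (D ^ (Fintype.card ι + 1)) ^ (Fintype.card ι + 1) := by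
  have h0 : ∀ i, 0 ≤ f i := fun i => zero_le_one.trans (hf i)
  set c := Fintype.card ι
  have hgl : g l ≤ D ^ c := by
    have h1 : ∏ i, (if i = l then 1 else f i) ≤ ∏ i, (D * if i = l then 1 else g i) := by
      refine Finset.prod_le_prod (fun i _ => ?_) fun i _ => ?_
      · split_ifs
        exacts [zero_le_one, h0 i]
      · split_ifs
        exacts [by simpa using hD, hfg i i]
    have h2 : ∏ i, g i = g l * ∏ i, if i = l then 1 else g i := by
      rw [Fintype.prod_eq_mul_prod_compl l g, Fintype.prod_eq_mul_prod_compl l]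
      simp only [if_true, one_mul]
      congr 1
      refine Finset.prod_congr rfl fun i hi => (if_neg ?_).symm
      simpa using hi
    have hpos : 0 < ∏ i, if i = l then 1 else g i := Finset.prod_pos fun i _ => by
      split_ifs
      exacts [one_pos, zero_lt_one.trans_le (hg i)]
    rw [Finset.prod_mul_distrib, Finset.prod_const, Finset.card_univ] at h1
    have h3 := h.trans h1
    rw [h2] at h3
    exact le_of_mul_le_mul_right h3 hpos
  have hE : 1 ≤ D ^ (c + 1) := one_le_pow₀ hD
  have hfE : ∀ i, f i ≤ D ^ (c + 1) := fun i => by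
    rw [pow_succ']
    exact (hfg i l).trans (mul_le_mul_of_nonneg_left hgl (zero_le_one.trans hD))
  constructor
  · exact (hfE i).trans (le_self_pow₀ hE (by omega))
  · calc g i ≤ ∏ i, g i := by
          rw [Fintype.prod_eq_mul_prod_compl i]
          refine le_mul_of_one_le_right (zero_le_one.trans (hg i)) ?_
          rw [← Finset.prod_const_one (s := {i}ᶜ)]
          exact Finset.prod_le_prod (fun _ _ => zero_le_one) fun j _ => hg j
      _ ≤ ∏ i, if i = l then 1 else f i := h
      _ ≤ ∏ _i : ι, D ^ (c + 1) := by
          refine Finset.prod_le_prod (fun i _ => ?_) fun i _ => ?_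
          · split_ifs
            exacts [zero_le_one, h0 i]
          · split_ifs
            exacts [hE, hfE i]
      _ = (D ^ (c + 1)) ^ c := by simp [c]
      _ ≤ _ := pow_le_pow_right₀ hE (by omega)

section Blocks

variable {K : Type*} [NormedField K] [IsUltrametricDist K] [ProperSpace K] {ι : Type*} [Fintype ι]
  [DecidableEq ι]

/-- Comparison of the Iwasawa coordinates of the two halves of `[[x*, y], [0, x]]`. -/
lemma prod_norm_inr_le_prod_norm_inl {u : Matrix (ι ⊕ ι) (ι ⊕ ι) K} {xs x y w : Matrix ι ι K}
    {b : ι ⊕ ι → K} {Q : Matrix (ι ⊕ ι) ((ι ⊕ ι) ⊕ (ι ⊕ ι)) K}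
    {P : Matrix ((ι ⊕ ι) ⊕ (ι ⊕ ι)) (ι ⊕ ι) K} (l : ι)
    (hw : w * w = 1) (hw1 : ∀ i j, ‖w i j‖ ≤ 1) (hxs : xs = w * xᵀ * w) (hxl : ∀ j, xs l j = 0)
    (hul : ∀ j, u (Sum.inl l) (Sum.inl j) = (1 : Matrix ι ι K) l j)
    (hu21 : u.toBlocks₂₁ = 0) (hu11 : u.toBlocks₁₁.det = 1) (hu22 : u.toBlocks₂₂.det = 1)
    (hQ : ∀ i j, ‖Q i j‖ ≤ 1) (hP : ∀ i j, ‖P i j‖ ≤ 1)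
    (huR : u * Matrix.fromCols (Matrix.fromBlocks xs y 0 x) 1 = Matrix.diagonal b * Q)
    (hQP : Q * P = 1) :
    ∏ i, ‖b (Sum.inr i)‖ ≤ ∏ i, if i = l then 1 else ‖b (Sum.inl i)‖ := by
  have hu : u = fromBlocks u.toBlocks₁₁ u.toBlocks₁₂ 0 u.toBlocks₂₂ := by
    conv_lhs => rw [← fromBlocks_toBlocks u, hu21]
  have hmul : ∀ M₁ M₂ : Matrix (ι ⊕ ι) (ι ⊕ ι) K,
      u * (fromBlocks xs y 0 x * M₁ + M₂) = diagonal b * (Q * fromRows M₁ M₂) := by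
    intro M₁ M₂
    rw [← Matrix.mul_assoc, ← huR, Matrix.mul_assoc, fromCols_mul_fromRows, Matrix.one_mul]
  obtain ⟨C, hC, hmax⟩ := exists_norm_det_le_norm_det_one_add_mul x
  have hbot : ∏ i, ‖b (Sum.inr i)‖ ≤ ‖(1 + x * C).det‖ := by
    have h1 := hmul P.toRows₁ P.toRows₂
    rw [fromRows_toRows, hQP, Matrix.mul_one, hu, ← fromBlocks_toBlocks P.toRows₁,
      ← fromBlocks_toBlocks P.toRows₂, fromBlocks_multiply, fromBlocks_add,
      fromBlocks_multiply] at h1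
    have h2 := congrArg (fun M => M.toBlocks₂₂.det) h1
    have h3 : (diagonal b).toBlocks₂₂ = diagonal (fun i => b (Sum.inr i)) := by
      ext i j
      simp [toBlocks₂₂, diagonal_apply]
    simp only [toBlocks_fromBlocks₂₂, h3, Matrix.zero_mul, zero_add, det_mul, hu22, one_mul,
      det_diagonal] at h2
    rw [← norm_prod, ← h2]
    exact hmax _ _ (fun i j => hP _ _) (fun i j => hP _ _)
  refine hbot.trans ?_
  set C' := w * Cᵀ * w with hC'
  have hC'1 : ∀ i j, ‖C' i j‖ ≤ 1 := fun i j => by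
    have h1 : ∀ i j, ‖(w * Cᵀ) i j‖ ≤ 1 := fun i j => by
      simpa using norm_mul_apply_le zero_le_one zero_le_one (hw1 i) (fun k => hC j k)
    simpa using norm_mul_apply_le zero_le_one zero_le_one (h1 i) (fun k => hw1 k j)
  have hdet : (1 + x * C).det = (xs * C' + 1).det := by
    have h1 : xs * C' + 1 = w * (1 + C * x)ᵀ * w := by
      rw [transpose_add, transpose_one, transpose_mul, Matrix.mul_add, Matrix.mul_one,
        Matrix.add_mul, hw, hxs, hC', add_comm]
      congr 1
      calc w * xᵀ * w * (w * Cᵀ * w) = w * xᵀ * (w * w) * Cᵀ * w := by simp only [Matrix.mul_assoc]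
        _ = w * (xᵀ * Cᵀ) * w := by rw [hw]; simp only [Matrix.mul_one, Matrix.mul_assoc]
    have h2 : w.det * w.det = 1 := by rw [← det_mul, hw, det_one]
    rw [h1, det_mul, det_mul, det_transpose, mul_right_comm, h2, one_mul, det_one_add_mul_comm]
  have h1 := hmul (fromBlocks C' 0 0 0) (fromBlocks 1 0 0 0)
  set M : Matrix ((ι ⊕ ι) ⊕ (ι ⊕ ι)) (ι ⊕ ι) K :=
    fromRows (fromBlocks C' 0 0 0) (fromBlocks 1 0 0 0) with hM
  have hM1 : ∀ i j, ‖M i j‖ ≤ 1 := by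
    rintro ((i | i) | (i | i)) (j | j) <;> simp [hM, hC'1, norm_one_matrix_apply_le]
  rw [hu, fromBlocks_multiply, fromBlocks_add, fromBlocks_multiply] at h1
  have h2 := congrArg (fun M => M.toBlocks₁₁) h1
  simp only [toBlocks_fromBlocks₁₁, Matrix.mul_zero, Matrix.zero_mul, add_zero] at h2
  rw [hdet, ← one_mul (det _), ← hu11, ← det_mul]
  refine norm_det_le_prod _ _ fun i j => ?_
  split_ifs with hi
  · subst hi
    have h3 : ∀ j, (xs * C' + 1 : Matrix ι ι K) i j = (1 : Matrix ι ι K) i j := fun j => by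
      simp [Matrix.mul_apply, hxl]
    have h4 : (u.toBlocks₁₁ * (xs * C' + 1)) i j = (xs * C' + 1 : Matrix ι ι K) i j := by
      rw [Matrix.mul_apply]
      simp [toBlocks₁₁, hul, Matrix.one_apply]
    rw [h4, h3]
    exact norm_one_matrix_apply_le i j
  · rw [h2]
    simp only [toBlocks₁₁, of_apply, diagonal_mul, norm_mul]
    refine mul_le_of_le_one_right (norm_nonneg _) ?_
    simpa using norm_mul_apply_le zero_le_one zero_le_one (hQ (Sum.inl i))
      (fun k => hM1 k (Sum.inl j))

end Blocks

section Transvection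

variable {K : Type*} [Field K] {ι : Type*} [Fintype ι] [DecidableEq ι]

/-- The symplectic transformation `1 + s • (J c ⊗ d + J d ⊗ c)`. -/
def symplecticTransvection (J : Matrix ι ι K) (s : K) (c d : ι → K) : Matrix ι ι K :=
  1 + s • (vecMulVec (J *ᵥ c) d + vecMulVec (J *ᵥ d) c)

omit [DecidableEq ι] in
lemma dotProduct_mulVec_comm_of_transpose_eq_neg {J : Matrix ι ι K} (hJ : Jᵀ = -J)
    (c d : ι → K) : c ⬝ᵥ (J *ᵥ d) = -(d ⬝ᵥ (J *ᵥ c)) := by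
  rw [dotProduct_mulVec, ← mulVec_transpose, hJ, neg_mulVec, neg_dotProduct, dotProduct_comm]

lemma symplecticTransvection_mem [CharZero K] {J : Matrix ι ι K} (hJ : Jᵀ = -J) (hJ2 : J * J = -1)
    {s : K} {c d : ι → K} (hcd : c ⬝ᵥ (J *ᵥ d) = 0) :
    (symplecticTransvection J s c d)ᵀ * J * symplecticTransvection J s c d = J := by
  have hself : ∀ c : ι → K, c ⬝ᵥ (J *ᵥ c) = 0 := fun c =>
    self_eq_neg.1 (dotProduct_mulVec_comm_of_transpose_eq_neg hJ c c)
  have hdc : d ⬝ᵥ (J *ᵥ c) = 0 := by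
    rw [dotProduct_mulVec_comm_of_transpose_eq_neg hJ, hcd, neg_zero]
  have h1 : ∀ c : ι → K, (J *ᵥ c) ᵥ* J = c := fun c => by
    rw [← mulVec_transpose, hJ, neg_mulVec, mulVec_mulVec, hJ2, neg_mulVec, one_mulVec, neg_neg]
  have h2 : ∀ c : ι → K, J *ᵥ (J *ᵥ c) = -c := fun c => by
    rw [mulVec_mulVec, hJ2, neg_mulVec, one_mulVec]
  set X := vecMulVec (J *ᵥ c) d + vecMulVec (J *ᵥ d) c with hX
  have hXJ : Xᵀ * J = vecMulVec d c + vecMulVec c d := by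
    simp only [hX, transpose_add, transpose_vecMulVec, Matrix.add_mul, vecMulVec_mul, h1]
  have hJX : J * X = -(vecMulVec d c + vecMulVec c d) := by
    simp only [hX, Matrix.mul_add, mul_vecMulVec, h2, neg_vecMulVec]
    abel
  have hXJX : Xᵀ * J * X = 0 := by
    rw [hXJ]
    simp [hX, Matrix.add_mul, Matrix.mul_add, vecMulVec_mul_vecMulVec, hself, hcd, hdc]
  calc (1 + s • X)ᵀ * J * (1 + s • X)
      = J + s • (Xᵀ * J + J * X) + (s * s) • (Xᵀ * J * X) := by
        simp only [transpose_add, transpose_one, transpose_smul, Matrix.add_mul, Matrix.mul_add,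
          Matrix.one_mul, Matrix.mul_one, Matrix.smul_mul, Matrix.mul_smul, smul_smul, smul_add]
        abel
    _ = J := by rw [hXJX, hXJ, hJX, add_neg_cancel, smul_zero, smul_zero, add_zero, add_zero]

lemma mul_symplecticTransvection {J u : Matrix ι ι K} (hu : u * J * uᵀ = J) (s : K) (c d : ι → K) :
    u * symplecticTransvection J s (c ᵥ* u) (d ᵥ* u) = symplecticTransvection J s c d * u := by
  have h1 : ∀ c : ι → K, u *ᵥ (J *ᵥ (c ᵥ* u)) = J *ᵥ c := fun c => by
    rw [← mulVec_transpose, mulVec_mulVec, mulVec_mulVec, hu]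
  simp [symplecticTransvection, Matrix.mul_add, Matrix.add_mul, mul_vecMulVec, vecMulVec_mul, h1]

lemma mul_mul_transpose_eq_of_transpose_mul_mul_eq {J u : Matrix ι ι K} (hJ2 : J * J = -1)
    (hu : uᵀ * J * u = J) : u * J * uᵀ = J := by
  have h1 : (-J * uᵀ * J) * u = 1 := by
    calc (-J * uᵀ * J) * u = -J * (uᵀ * J * u) := by simp only [Matrix.mul_assoc]
      _ = 1 := by rw [hu, Matrix.neg_mul, hJ2, neg_neg]
  have h2 : u * (-J * uᵀ * J) = 1 := mul_eq_one_comm.1 h1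
  calc u * J * uᵀ = (u * (-J * uᵀ * J)) * J := by
        simp only [Matrix.mul_assoc, hJ2, Matrix.neg_mul, Matrix.mul_neg, Matrix.mul_one, neg_neg]
    _ = J := by rw [h2, Matrix.one_mul]

end Transvection

lemma IsUnipUpper.mulVec_apply {K : Type*} [Field K] {m : ℕ} {U : Matrix (Fin m) (Fin m) K}
    (hU : IsUnipUpper U) {x : Fin m → K} {i : Fin m} (hx : ∀ t, i < t → x t = 0) :
    (U *ᵥ x) i = x i := by
  rw [mulVec, dotProduct, Finset.sum_eq_single i]
  · rw [hU.2, one_mul]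
  · intro t _ ht
    rcases lt_or_gt_of_ne ht with h | h
    · rw [hU.1 i t h, zero_mul]
    · rw [hx t h, mul_zero]
  · simp

lemma IsUnipUpper.eq_zero_of_mulVec_eq_zero {K : Type*} [Field K] {m : ℕ}
    {U : Matrix (Fin m) (Fin m) K} (hU : IsUnipUpper U) {x : Fin m → K} {i : Fin m}
    (hx : ∀ t, i < t → (U *ᵥ x) t = 0) (t : Fin m) (ht : i < t) : x t = 0 := by
  induction t using WellFoundedGT.induction with
  | ind t ih =>
    rw [← hU.mulVec_apply fun k hk => ih k hk (ht.trans hk)]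
    exact hx t ht

lemma IsUnipUpper.det_eq_one {K : Type*} [Field K] {m : ℕ} {U : Matrix (Fin m) (Fin m) K}
    (hU : IsUnipUpper U) : U.det = 1 := by
  rw [Matrix.det_of_isUpperTriangular fun i j h => hU.1 i j h]
  simp [hU.2]

section Form

variable (p : ℕ) [Fact p.Prime]

@[simp]
lemma sumEquiv_inl_val (k : ℕ) (i : Fin k) : (sumEquiv k (Sum.inl i) : ℕ) = i := by
  simp [sumEquiv]

@[simp]
lemma sumEquiv_inr_val (k : ℕ) (i : Fin k) : (sumEquiv k (Sum.inr i) : ℕ) = k + i := by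
  simp [sumEquiv, add_comm]

lemma wa_apply (k : ℕ) (i j : Fin k) : wa p k i j = if j = i.rev then 1 else 0 := by
  simp only [wa, of_apply]
  congr 1
  rw [Fin.ext_iff, Fin.val_rev]
  simp only [eq_iff_iff]
  omega

lemma wa_mul_wa (k : ℕ) : wa p k * wa p k = 1 := by
  ext i j
  rw [Matrix.mul_apply, Finset.sum_eq_single i.rev]
  · simp [wa_apply, Matrix.one_apply, eq_comm (a := i)]
  · intro x _ hx
    rw [wa_apply, if_neg hx, zero_mul]
  · simp

lemma transpose_wa (k : ℕ) : (wa p k)ᵀ = wa p k := by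
  ext i j
  simp [wa, add_comm]

lemma norm_wa_apply_le (k : ℕ) (i j : Fin k) : ‖wa p k i j‖ ≤ 1 := by
  rw [wa_apply]
  split_ifs <;> simp

lemma blk_transpose {k : ℕ} (A B C D : Matrix (Fin k) (Fin k) ℚ_[p]) :
    (blk p A B C D)ᵀ = blk p Aᵀ Cᵀ Bᵀ Dᵀ := by
  simp [blk, fromBlocks_transpose]

lemma blk_mul {k : ℕ} (A B C D A' B' C' D' : Matrix (Fin k) (Fin k) ℚ_[p]) :
    blk p A B C D * blk p A' B' C' D' =
      blk p (A * A' + B * C') (A * B' + B * D') (C * A' + D * C') (C * B' + D * D') := by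
  simp [blk, fromBlocks_multiply]

lemma blk_one {k : ℕ} : blk p (1 : Matrix (Fin k) (Fin k) ℚ_[p]) 0 0 1 = 1 := by
  simp [blk]

lemma blk_neg {k : ℕ} (A B C D : Matrix (Fin k) (Fin k) ℚ_[p]) :
    -blk p A B C D = blk p (-A) (-B) (-C) (-D) := by
  simp [blk, ← fromBlocks_neg]
  rfl

lemma blk_zero_wa_transpose (m : ℕ) :
    (blk p 0 (wa p m) (-(wa p m)) 0)ᵀ = -blk p 0 (wa p m) (-(wa p m)) 0 := by
  simp [blk_transpose, blk_neg, transpose_wa]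

lemma blk_zero_wa_mul_self (m : ℕ) :
    blk p 0 (wa p m) (-(wa p m)) 0 * blk p 0 (wa p m) (-(wa p m)) 0 = -1 := by
  simp [blk_mul, wa_mul_wa, ← blk_one p, blk_neg]

lemma blk_zero_wa_mulVec (m : ℕ) (e : Fin (2 * m) → ℚ_[p]) (i : Fin (2 * m)) :
    (blk p 0 (wa p m) (-(wa p m)) 0 *ᵥ e) i = (if (i : ℕ) < m then 1 else -1) * e i.rev := by
  have h : ∀ j, blk p 0 (wa p m) (-(wa p m)) 0 i j =
      if j = i.rev then (if (i : ℕ) < m then 1 else -1) else 0 := by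
    intro j
    obtain ⟨i, rfl⟩ := (sumEquiv m).surjective i
    obtain ⟨j, rfl⟩ := (sumEquiv m).surjective j
    rcases i with i | i <;> rcases j with j | j <;>
      simp [blk, wa_apply, Fin.ext_iff, Fin.val_rev]
    · omega
    · congr 1
      simp only [eq_iff_iff]
      omega
    · split_ifs <;> first | rfl | omega
    · omega
  simp [mulVec, dotProduct, h]

end Form

section UnipotentElement

variable {p : ℕ} [Fact p.Prime] {m : ℕ} {e δ : Fin (2 * m) → ℚ_[p]} {i j : ℕ}

lemma neg_blk_zero_wa_mulVec_dotProduct_eq_zero (hij : j = i + 1)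
    (hδ : ∀ t : Fin (2 * m), (t : ℕ) < m + j → δ t = 0)
    (he : ∀ t : Fin (2 * m), m + i < (t : ℕ) → e t = 0) :
    (-((blk p 0 (wa p m) (-(wa p m)) 0) *ᵥ e)) ⬝ᵥ ((blk p 0 (wa p m) (-(wa p m)) 0) *ᵥ δ) = 0 := by
  refine Finset.sum_eq_zero fun t _ => ?_
  rw [Pi.neg_apply, blk_zero_wa_mulVec, blk_zero_wa_mulVec]
  rcases lt_or_ge (t.rev : ℕ) (m + j) with h | h
  · rw [hδ _ h]; simp
  · rw [he _ (by omega)]; simp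

lemma symplecticTransvection_apply (s : ℚ_[p]) (a c : Fin (2 * m)) :
    symplecticTransvection (blk p 0 (wa p m) (-(wa p m)) 0) s
          (-((blk p 0 (wa p m) (-(wa p m)) 0) *ᵥ e)) δ a c =
      (1 : Matrix _ _ ℚ_[p]) a c +
      s * (e a * δ c - (if (a : ℕ) < m then 1 else -1) * δ a.rev *
        ((if (c : ℕ) < m then 1 else -1) * e c.rev)) := by
  have h : (blk p 0 (wa p m) (-(wa p m)) 0) *ᵥ (-((blk p 0 (wa p m) (-(wa p m)) 0) *ᵥ e)) = e := by
    rw [mulVec_neg, mulVec_mulVec, blk_zero_wa_mul_self, neg_mulVec, one_mulVec, neg_neg]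
  rw [symplecticTransvection, h, Matrix.add_apply, Matrix.smul_apply, Matrix.add_apply,
    vecMulVec_apply, vecMulVec_apply, Pi.neg_apply, blk_zero_wa_mulVec, blk_zero_wa_mulVec,
    smul_eq_mul, mul_neg, sub_eq_add_neg]

lemma isUnipUpper_symplecticTransvection (hij : j = i + 1)
    (hδ : ∀ t : Fin (2 * m), (t : ℕ) < m + j → δ t = 0)
    (he : ∀ t : Fin (2 * m), m + i < (t : ℕ) → e t = 0) (s : ℚ_[p]) :
    IsUnipUpper (symplecticTransvection (blk p 0 (wa p m) (-(wa p m)) 0) s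
          (-((blk p 0 (wa p m) (-(wa p m)) 0) *ᵥ e)) δ) := by
  have h : ∀ a c : Fin (2 * m), c ≤ a →
      symplecticTransvection (blk p 0 (wa p m) (-(wa p m)) 0) s
          (-((blk p 0 (wa p m) (-(wa p m)) 0) *ᵥ e)) δ a c =
        (1 : Matrix _ _ ℚ_[p]) a c := by
    intro a c hca
    have h1 : e a * δ c = 0 := by
      rcases lt_or_ge (c : ℕ) (m + j) with h | h
      · rw [hδ _ h, mul_zero]
      · rw [he _ (by omega), zero_mul]
    have h2 : δ a.rev * e c.rev = 0 := by
      rcases lt_or_ge (a.rev : ℕ) (m + j) with h | h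
      · rw [hδ _ h, zero_mul]
      · rw [he c.rev (by rw [Fin.val_rev] at h ⊢; omega), mul_zero]
    rw [symplecticTransvection_apply, h1, mul_mul_mul_comm, h2]
    simp
  refine ⟨fun a c hca => ?_, fun a => ?_⟩
  · rw [h a c hca.le, Matrix.one_apply_ne (Fin.ne_of_gt hca)]
  · rw [h a a le_rfl, Matrix.one_apply_eq]

lemma sdSumUpTo_symplecticTransvection (hij : j = i + 1) (hj : j < m)
    (hδ : ∀ t : Fin (2 * m), (t : ℕ) < m + j → δ t = 0) (hδ1 : δ ⟨m + j, by omega⟩ = 1)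
    (he : ∀ t : Fin (2 * m), m + i < (t : ℕ) → e t = 0) (he1 : e ⟨m + i, by omega⟩ = 1)
    (s : ℚ_[p]) :
    sdSumUpTo (2 * m) (m - 1) (symplecticTransvection (blk p 0 (wa p m) (-(wa p m)) 0) s
          (-((blk p 0 (wa p m) (-(wa p m)) 0) *ᵥ e)) δ) = -s := by
  have key : ∀ t : Fin (m - 1), ∀ h : (t : ℕ) + 1 < 2 * m,
      symplecticTransvection (blk p 0 (wa p m) (-(wa p m)) 0) s
          (-((blk p 0 (wa p m) (-(wa p m)) 0) *ᵥ e)) δ ⟨t, by omega⟩ ⟨t + 1, h⟩ =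
        if (t : ℕ) = m - 1 - j then -s else 0 := by
    intro t h
    have ht := t.2
    rw [symplecticTransvection_apply, Matrix.one_apply_ne (by simp), hδ ⟨t + 1, h⟩ (by simp; omega),
      if_pos (by simp; omega), if_pos (by simp; omega)]
    split_ifs with htj
    · rw [show Fin.rev ⟨(t : ℕ), by omega⟩ = (⟨m + j, by omega⟩ : Fin (2 * m)) by
          rw [Fin.ext_iff, Fin.val_rev]; simp; omega,
        show Fin.rev ⟨(t : ℕ) + 1, h⟩ = (⟨m + i, by omega⟩ : Fin (2 * m)) by
          rw [Fin.ext_iff, Fin.val_rev]; simp; omega, hδ1, he1]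
      ring
    · rcases lt_or_gt_of_ne htj with h' | h'
      · rw [he (Fin.rev ⟨(t : ℕ) + 1, h⟩) (by rw [Fin.val_rev]; simp; omega)]
        ring
      · rw [hδ (Fin.rev ⟨(t : ℕ), by omega⟩) (by rw [Fin.val_rev]; simp; omega)]
        ring
  rw [sdSumUpTo, Finset.sum_eq_single ⟨m - 1 - j, by omega⟩]
  · rw [dif_pos (by simp; omega), key, if_pos rfl]
  · intro t _ ht
    split_ifs with h
    · rw [key, if_neg (by simpa [Fin.ext_iff] using ht)]
    · rfl
  · simp

end UnipotentElement

lemma exists_isUnipUpper_mul_eq_mul {p : ℕ} [Fact p.Prime] {m : ℕ} {J : Matrix _ _ ℚ_[p]}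
    (hJ : J = blk p 0 (wa p m) (-(wa p m)) 0) {u : Matrix (Fin (2 * m)) (Fin (2 * m)) ℚ_[p]}
    (hu : uᵀ * J * u = J) {U : Matrix (Fin m) (Fin m) ℚ_[p]} {b : Fin m → ℚ_[p]}
    {Q : Matrix (Fin m) (Fin (2 * m)) ℚ_[p]} {P : Matrix (Fin (2 * m)) (Fin m) ℚ_[p]}
    (hU : IsUnipUpper U) (hb : ∀ i, b i ≠ 0) (hQ : ∀ i j, ‖Q i j‖ ≤ 1) (hP : ∀ i j, ‖P i j‖ ≤ 1)
    (hUR : U * u.submatrix (fun t => sumEquiv m (Sum.inr t)) id = diagonal b * Q)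
    (hQP : Q * P = 1) {i j : Fin m} (hij : (j : ℕ) = i + 1) (s : ℚ_[p]) :
    ∃ v k : Matrix (Fin (2 * m)) (Fin (2 * m)) ℚ_[p], vᵀ * J * v = J ∧ kᵀ * J * k = J ∧
      v * u = u * k ∧ IsUnipUpper v ∧ sdSumUpTo (2 * m) (m - 1) v = -s ∧
      ∀ a c, ‖(k - 1) a c‖ ≤ ‖s‖ * (‖b j‖ / ‖b i‖) := by
  have hJt : Jᵀ = -J := hJ ▸ blk_zero_wa_transpose p m
  have hJ2 : J * J = -1 := hJ ▸ blk_zero_wa_mul_self p m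
  have hnJ : ∀ x : Fin (2 * m) → ℚ_[p], ∀ B : ℝ, (∀ t, ‖x t‖ ≤ B) → ∀ t, ‖(J *ᵥ x) t‖ ≤ B := by
    intro x B hx t
    rw [hJ, blk_zero_wa_mulVec, norm_mul]
    split_ifs <;> simpa using hx _
  have huJu := mul_mul_transpose_eq_of_transpose_mul_mul_eq hJ2 hu
  set R := u.submatrix (fun t => sumEquiv m (Sum.inr t)) id with hR
  set c : Fin (2 * m) → ℚ_[p] := fun t => (b i)⁻¹ * P t i with hc
  set e := u *ᵥ c with he
  set δ : Fin (2 * m) → ℚ_[p] := fun t => Sum.elim 0 (U j) ((sumEquiv m).symm t) with hδ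
  have hlt : ∀ {t : Fin m} {k : ℕ}, m + k < (sumEquiv m (Sum.inr t) : ℕ) → k < t := by
    intro t k h
    rw [sumEquiv_inr_val] at h
    omega
  have hδ0 : ∀ t : Fin (2 * m), (t : ℕ) < m + j → δ t = 0 := by
    intro t ht
    obtain ⟨t | t, rfl⟩ := (sumEquiv m).surjective t
    · simp [hδ]
    · rw [sumEquiv_inr_val] at ht
      simp [hδ, hU.1 j t (by omega)]
  have hδ1 : δ ⟨m + j, by omega⟩ = 1 := by
    rw [show (⟨m + j, by omega⟩ : Fin (2 * m)) = sumEquiv m (Sum.inr j) by simp [Fin.ext_iff]]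
    simp [hδ, hU.2]
  have hRc : ∀ t, e (sumEquiv m (Sum.inr t)) = (R *ᵥ c) t := fun t => rfl
  have hURc : ∀ t, (U *ᵥ (R *ᵥ c)) t = (1 : Matrix (Fin m) (Fin m) ℚ_[p]) t i := by
    intro t
    have h1 : c = (b i)⁻¹ • (P *ᵥ Pi.single i 1) := by
      ext t
      simp [hc]
    rw [mulVec_mulVec, hUR, h1, mulVec_smul, mulVec_mulVec, Matrix.mul_assoc, hQP, Matrix.mul_one]
    rcases eq_or_ne t i with rfl | hti
    · simp [hb]
    · simp [hti]
  have hRc0 : ∀ t, i < t → (R *ᵥ c) t = 0 := fun t ht =>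
    hU.eq_zero_of_mulVec_eq_zero (i := i)
      (fun t ht => by rw [hURc, Matrix.one_apply_ne ht.ne']) t ht
  have he0 : ∀ t : Fin (2 * m), m + i < (t : ℕ) → e t = 0 := by
    intro t ht
    obtain ⟨t | t, rfl⟩ := (sumEquiv m).surjective t
    · rw [sumEquiv_inl_val] at ht
      omega
    · exact (hRc t).trans (hRc0 t (hlt ht))
  have he1 : e ⟨m + i, by omega⟩ = 1 := by
    rw [show (⟨m + i, by omega⟩ : Fin (2 * m)) = sumEquiv m (Sum.inr i) by simp [Fin.ext_iff],
      hRc, ← hU.mulVec_apply hRc0, hURc, Matrix.one_apply_eq]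
  have hδu : δ ᵥ* u = fun t => b j * Q j t := by
    ext t
    rw [← diagonal_mul, ← hUR, vecMul, dotProduct, ← (sumEquiv m).sum_comp, Fintype.sum_sum_type,
      Matrix.mul_apply]
    simp [hδ, hR]
  have hγu : (-(J *ᵥ e)) ᵥ* u = -(J *ᵥ c) := by
    have hJe : J *ᵥ e = -(e ᵥ* J) := by rw [← mulVec_transpose, hJt, neg_mulVec, neg_neg]
    rw [hJe, neg_neg, vecMul_vecMul, he, ← vecMul_transpose, vecMul_vecMul, ← Matrix.mul_assoc, hu,
      ← mulVec_transpose, hJt, neg_mulVec]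
  have hγδ : (-(J *ᵥ e)) ⬝ᵥ (J *ᵥ δ) = 0 := by
    rw [hJ]
    exact neg_blk_zero_wa_mulVec_dotProduct_eq_zero hij hδ0 he0
  have hγδu : ((-(J *ᵥ e)) ᵥ* u) ⬝ᵥ (J *ᵥ (δ ᵥ* u)) = 0 := by
    rw [← hγδ, ← dotProduct_mulVec, ← mulVec_transpose u δ]
    congr 1
    rw [mulVec_mulVec, mulVec_mulVec, huJu]
  refine ⟨_, _, symplecticTransvection_mem hJt hJ2 hγδ (s := s),
    symplecticTransvection_mem hJt hJ2 hγδu (s := s),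
    (mul_symplecticTransvection huJu s _ _).symm, ?_, ?_, ?_⟩
  · rw [hJ]
    exact isUnipUpper_symplecticTransvection hij hδ0 he0 s
  · rw [hJ]
    exact sdSumUpTo_symplecticTransvection hij j.2 hδ0 hδ1 he0 he1 s
  · intro a d
    have hc1 : ∀ t, ‖c t‖ ≤ ‖b i‖⁻¹ := fun t => by
      rw [hc, norm_mul, norm_inv]
      exact mul_le_of_le_one_right (by positivity) (hP _ _)
    have hd1 : ∀ t, ‖(δ ᵥ* u) t‖ ≤ ‖b j‖ := fun t => by
      rw [hδu, norm_mul]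
      exact mul_le_of_le_one_right (by positivity) (hQ _ _)
    have hγ1 : ∀ t, ‖((-(J *ᵥ e)) ᵥ* u) t‖ ≤ ‖b i‖⁻¹ := fun t => by
      rw [hγu, Pi.neg_apply, norm_neg]
      exact hnJ c _ hc1 t
    rw [symplecticTransvection, add_sub_cancel_left, Matrix.smul_apply, smul_eq_mul, norm_mul]
    refine mul_le_mul_of_nonneg_left ?_ (norm_nonneg _)
    rw [Matrix.add_apply, vecMulVec_apply, vecMulVec_apply]
    refine (IsUltrametricDist.norm_add_le_max _ _).trans (max_le ?_ ?_)
    · rw [norm_mul, div_eq_mul_inv, mul_comm ‖b j‖]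
      exact mul_le_mul (hnJ _ _ hγ1 a) (hd1 d) (norm_nonneg _) (by positivity)
    · rw [norm_mul, div_eq_mul_inv]
      exact mul_le_mul (hnJ _ _ hd1 a) (hγ1 d) (norm_nonneg _) (by positivity)

section SymplecticGroup

variable {p : ℕ} [Fact p.Prime] {n : ℕ}

lemma Jmat_mul_self : Jmat p n * Jmat p n = -1 := blk_zero_wa_mul_self p (2 * n)

lemma exists_mem_SpSet_coe_eq {g : Matrix (Fin (2 * (2 * n))) (Fin (2 * (2 * n))) ℚ_[p]}
    (hg : gᵀ * Jmat p n * g = Jmat p n) :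
    ∃ g' ∈ SpSet p n, (g' : Matrix (Fin (2 * (2 * n))) (Fin (2 * (2 * n))) ℚ_[p]) = g := by
  have h1 : (-Jmat p n * gᵀ * Jmat p n) * g = 1 := by
    calc (-Jmat p n * gᵀ * Jmat p n) * g = -Jmat p n * (gᵀ * Jmat p n * g) := by
          simp only [Matrix.mul_assoc]
      _ = 1 := by rw [hg, Matrix.neg_mul, Jmat_mul_self, neg_neg]
  exact ⟨⟨g, _, mul_eq_one_comm.1 h1, h1⟩, hg, rfl⟩

lemma coe_inv_of_mem_SpSet {g : GL (Fin (2 * (2 * n))) ℚ_[p]} (hg : g ∈ SpSet p n) :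
    ((g⁻¹ : GL (Fin (2 * (2 * n))) ℚ_[p]) : Matrix (Fin (2 * (2 * n))) (Fin (2 * (2 * n))) ℚ_[p]) =
      -(Jmat p n * (g : Matrix (Fin (2 * (2 * n))) (Fin (2 * (2 * n))) ℚ_[p])ᵀ * Jmat p n) := by
  have hg' : (g : Matrix (Fin (2 * (2 * n))) (Fin (2 * (2 * n))) ℚ_[p])ᵀ * Jmat p n * g =
    Jmat p n := hg
  refine Units.inv_eq_of_mul_eq_one_left ?_
  calc -(Jmat p n * (g : Matrix (Fin (2 * (2 * n))) (Fin (2 * (2 * n))) ℚ_[p])ᵀ * Jmat p n) * g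
      = -(Jmat p n *
          ((g : Matrix (Fin (2 * (2 * n))) (Fin (2 * (2 * n))) ℚ_[p])ᵀ * Jmat p n * g)) := by
        simp only [Matrix.mul_assoc, Matrix.neg_mul]
    _ = 1 := by rw [hg', Jmat_mul_self, neg_neg]

lemma exists_pos_forall_norm_sub_one_le_mem {V : Set (GL (Fin (2 * (2 * n))) ℚ_[p])}
    (hV : IsOpen V) (hV1 : 1 ∈ V) :
    ∃ ε : ℝ, 0 < ε ∧ ∀ g ∈ SpSet p n,
      (∀ a c, ‖((g : Matrix (Fin (2 * (2 * n))) (Fin (2 * (2 * n))) ℚ_[p]) - 1) a c‖ ≤ ε) →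
        g ∈ V := by
  obtain ⟨O, hO, rfl⟩ := Units.isEmbedding_embedProduct.isInducing.isOpen_iff.1 hV
  let F : Matrix (Fin (2 * (2 * n))) (Fin (2 * (2 * n))) ℚ_[p] →
      Matrix (Fin (2 * (2 * n))) (Fin (2 * (2 * n))) ℚ_[p] ×
        (Matrix (Fin (2 * (2 * n))) (Fin (2 * (2 * n))) ℚ_[p])ᵐᵒᵖ :=
    fun g => (g, MulOpposite.op (-(Jmat p n * gᵀ * Jmat p n)))
  have hF : Continuous F := by
    unfold F
    fun_prop
  have hFg : ∀ g ∈ SpSet p n, F g = Units.embedProduct _ g := fun g hg => by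
    rw [Units.embedProduct_apply, coe_inv_of_mem_SpSet hg]
  have h1 : (1 : GL (Fin (2 * (2 * n))) ℚ_[p]) ∈ SpSet p n := by simp [SpSet]
  have hnhds : F ⁻¹' O ∈ nhds (1 : Matrix (Fin (2 * (2 * n))) (Fin (2 * (2 * n))) ℚ_[p]) := by
    refine (hO.preimage hF).mem_nhds ?_
    rw [Set.mem_preimage, ← Units.val_one, hFg 1 h1]
    exact hV1
  let _ := Matrix.normedAddCommGroup (m := Fin (2 * (2 * n))) (n := Fin (2 * (2 * n))) (α := ℚ_[p])
  obtain ⟨ε, hε, hsub⟩ := Metric.nhds_basis_closedBall.mem_iff.1 hnhds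
  refine ⟨ε, hε, fun g hg hgε => ?_⟩
  rw [Set.mem_preimage, ← hFg g hg]
  refine hsub (Metric.mem_closedBall.2 ?_)
  rw [dist_eq_norm, Matrix.norm_le_iff hε.le]
  exact hgε

lemma wa_two_mul : wa p (2 * n) = blk p 0 (wa p n) (wa p n) 0 := by
  ext i j
  obtain ⟨i, rfl⟩ := (sumEquiv n).surjective i
  obtain ⟨j, rfl⟩ := (sumEquiv n).surjective j
  rcases i with i | i <;> rcases j with j | j <;> simp [blk, wa] <;> first | omega | congr 1
  all_goals
    simp only [eq_iff_iff]
    omega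

lemma UbarSet_subset_SpSet : UbarSet p n ⊆ SpSet p n := by
  rintro u ⟨x, y, -, hy, hu⟩
  have hw := wa_mul_wa p n
  have hwx : wa p n * x = (wa p n * xᵀ * wa p n)ᵀ * wa p n := by
    rw [transpose_mul, transpose_mul, transpose_wa, transpose_transpose, Matrix.mul_assoc,
      Matrix.mul_assoc, hw, Matrix.mul_one]
  have hwx' : wa p n * (wa p n * xᵀ * wa p n) = xᵀ * wa p n := by
    rw [Matrix.mul_assoc, ← Matrix.mul_assoc, hw, Matrix.one_mul]
  have hwy : wa p n * y = yᵀ * wa p n := by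
    nth_rw 1 [← hy]
    rw [Matrix.mul_assoc, ← Matrix.mul_assoc, hw, Matrix.one_mul]
  change (u : Matrix (Fin (2 * (2 * n))) (Fin (2 * (2 * n))) ℚ_[p])ᵀ * Jmat p n * u = Jmat p n
  set z := blk p (wa p n * xᵀ * wa p n) y 0 x with hz
  have hwz : wa p (2 * n) * z = zᵀ * wa p (2 * n) := by
    rw [hz, wa_two_mul, blk_mul, blk_transpose, blk_mul]
    simp only [Matrix.zero_mul, Matrix.mul_zero, add_zero, zero_add, transpose_zero, ← hwx, hwx',
      hwy]
  rw [hu, ubarMat, ← hz, Jmat, blk_transpose, blk_mul, blk_mul]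
  simp [hwz]

lemma blk_add {k : ℕ} (A B C D A' B' C' D' : Matrix (Fin k) (Fin k) ℚ_[p]) :
    blk p A B C D + blk p A' B' C' D' = blk p (A + A') (B + B') (C + C') (D + D') := by
  simp only [blk, reindex_apply, ← fromBlocks_add]
  rfl

lemma continuous_blk {k : ℕ} {X : Type*} [TopologicalSpace X]
    {A B C D : X → Matrix (Fin k) (Fin k) ℚ_[p]} (hA : Continuous A) (hB : Continuous B)
    (hC : Continuous C) (hD : Continuous D) :
    Continuous fun z => blk p (A z) (B z) (C z) (D z) :=
  (hA.matrix_fromBlocks hB hC hD).matrix_submatrix _ _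

lemma ubarMat_mul_ubarMat (x y x' y' : Matrix (Fin n) (Fin n) ℚ_[p]) :
    ubarMat p x y * ubarMat p x' y' = ubarMat p (x + x') (y + y') := by
  have h : blk p (wa p n * xᵀ * wa p n) y 0 x + blk p (wa p n * x'ᵀ * wa p n) y' 0 x' =
      blk p (wa p n * (x + x')ᵀ * wa p n) (y + y') 0 (x + x') := by
    rw [blk_add, transpose_add, Matrix.mul_add, Matrix.add_mul, add_zero]
  simp only [ubarMat, blk_mul, ← h]
  simp

lemma ubarMat_zero : ubarMat p (0 : Matrix (Fin n) (Fin n) ℚ_[p]) 0 = 1 := by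
  rw [ubarMat, transpose_zero, Matrix.mul_zero, Matrix.zero_mul, ← blk_one p]
  simp [blk]

lemma continuous_ubarMat {X : Type*} [TopologicalSpace X]
    {x y : X → Matrix (Fin n) (Fin n) ℚ_[p]} (hx : Continuous x) (hy : Continuous y) :
    Continuous fun z => ubarMat p (x z) (y z) :=
  continuous_blk continuous_const continuous_const
    (continuous_blk (by fun_prop) hy continuous_const hx) continuous_const

/-- The matrix `ubarMat p x y` as an element of the general linear group. -/
noncomputable def ubarGL (x y : Matrix (Fin n) (Fin n) ℚ_[p]) : GL (Fin (2 * (2 * n))) ℚ_[p] where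
  val := ubarMat p x y
  inv := ubarMat p (-x) (-y)
  val_inv := by rw [ubarMat_mul_ubarMat, add_neg_cancel, add_neg_cancel, ubarMat_zero]
  inv_val := by rw [ubarMat_mul_ubarMat, neg_add_cancel, neg_add_cancel, ubarMat_zero]

lemma continuous_ubarGL {X : Type*} [TopologicalSpace X]
    {x y : X → Matrix (Fin n) (Fin n) ℚ_[p]} (hx : Continuous x) (hy : Continuous y) :
    Continuous fun z => ubarGL (x z) (y z) :=
  Units.continuous_iff.2 ⟨continuous_ubarMat hx hy, continuous_ubarMat hx.neg hy.neg⟩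

lemma isCompact_setOf_ubarMat_norm_le (r : ℝ) :
    IsCompact {u : GL (Fin (2 * (2 * n))) ℚ_[p] |
      ∃ x y : Matrix (Fin n) (Fin n) ℚ_[p],
        ((∀ i j : Fin n, (j : ℕ) = 0 → x i j = 0) ∧ wa p n * yᵀ * wa p n = y ∧
        (u : Matrix (Fin (2 * (2 * n))) (Fin (2 * (2 * n))) ℚ_[p]) = ubarMat p x y) ∧
        (∀ i j, ‖x i j‖ ≤ r) ∧ ∀ i j, ‖y i j‖ ≤ r} := by
  have hcl : IsClosed {z : Matrix (Fin n) (Fin n) ℚ_[p] × Matrix (Fin n) (Fin n) ℚ_[p] |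
      (∀ i j : Fin n, (j : ℕ) = 0 → z.1 i j = 0) ∧ wa p n * z.2ᵀ * wa p n = z.2} := by
    rw [Set.ofPred_and]
    refine IsClosed.inter ?_ (isClosed_eq (by fun_prop) continuous_snd)
    simp only [Set.ofPred_forall]
    exact isClosed_iInter fun i => isClosed_iInter fun j => isClosed_iInter fun _ =>
      isClosed_eq (continuous_fst.matrix_elem i j) continuous_const
  have hcpt := (((isCompact_setOf_norm_apply_le (K := ℚ_[p]) (ι := Fin n) (κ := Fin n) r).prod
    (isCompact_setOf_norm_apply_le r)).inter_right hcl).image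
      (continuous_ubarGL continuous_fst continuous_snd)
  convert hcpt using 1
  ext u
  constructor
  · rintro ⟨x, y, ⟨h1, h2, h3⟩, h4, h5⟩
    exact ⟨(x, y), ⟨⟨h4, h5⟩, h1, h2⟩, Units.ext h3.symm⟩
  · rintro ⟨⟨x, y⟩, ⟨⟨h4, h5⟩, h1, h2⟩, rfl⟩
    exact ⟨x, y, ⟨h1, h2, rfl⟩, h4, h5⟩

end SymplecticGroup

lemma ubarMat_apply_inr_inr {p : ℕ} [Fact p.Prime] {n : ℕ} (x y : Matrix (Fin n) (Fin n) ℚ_[p])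
    (i j : Fin (2 * n)) :
    ubarMat p x y (sumEquiv (2 * n) (Sum.inr i)) (sumEquiv (2 * n) (Sum.inr j)) =
      (1 : Matrix _ _ ℚ_[p]) i j := by
  simp [ubarMat, blk]

lemma ubarMat_apply_inr_inl {p : ℕ} [Fact p.Prime] {n : ℕ} (x y : Matrix (Fin n) (Fin n) ℚ_[p])
    (i j : Fin (2 * n)) :
    ubarMat p x y (sumEquiv (2 * n) (Sum.inr i)) (sumEquiv (2 * n) (Sum.inl j)) =
      blk p (wa p n * xᵀ * wa p n) y 0 x i j := by
  simp [ubarMat, blk]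

lemma wa_mul_mul_wa_apply {p : ℕ} [Fact p.Prime] {k : ℕ} (A : Matrix (Fin k) (Fin k) ℚ_[p])
    (i j : Fin k) : (wa p k * A * wa p k) i j = A i.rev j.rev := by
  have h : ∀ l, wa p k l j = if l = j.rev then 1 else 0 := fun l => by
    rw [← transpose_wa, transpose_apply, wa_apply]
  simp [Matrix.mul_apply, h, wa_apply]

lemma norm_le_pow_mul_norm {K : Type*} [NormedField K] {m : ℕ} {b : Fin m → K} {C : ℝ} (hC : 1 ≤ C)
    (hb : ∀ i j : Fin m, (j : ℕ) = i + 1 → ‖b i‖ ≤ C * ‖b j‖) (i j : Fin m) (hij : i ≤ j) :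
    ‖b i‖ ≤ C ^ m * ‖b j‖ := by
  have h : ∀ k : ℕ, ∀ j : Fin m, (j : ℕ) = i + k → ‖b i‖ ≤ C ^ k * ‖b j‖ := by
    intro k
    induction k with
    | zero =>
      intro j hj
      rw [show j = i from Fin.ext hj, pow_zero, one_mul]
    | succ k ih =>
      intro j hj
      calc ‖b i‖ ≤ C ^ k * ‖b ⟨i + k, by omega⟩‖ := ih _ rfl
        _ ≤ C ^ k * (C * ‖b j‖) := by
          gcongr
          exact hb _ _ (by simp only []; omega)
        _ = C ^ (k + 1) * ‖b j‖ := by ring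
  have hij' : (i : ℕ) ≤ j := hij
  refine (h (j - i) j (by omega)).trans ?_
  gcongr
  omega

lemma norm_apply_le_of_isUnipUpper_mul_eq {p : ℕ} [Fact p.Prime] {n : ℕ} (hn : 1 ≤ n)
    {x y : Matrix (Fin n) (Fin n) ℚ_[p]} (hx : ∀ i j : Fin n, (j : ℕ) = 0 → x i j = 0)
    {U : Matrix (Fin (2 * n)) (Fin (2 * n)) ℚ_[p]} {b : Fin (2 * n) → ℚ_[p]}
    {Q : Matrix (Fin (2 * n)) (Fin (2 * (2 * n))) ℚ_[p]}
    {P : Matrix (Fin (2 * (2 * n))) (Fin (2 * n)) ℚ_[p]}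
    (hU : IsUnipUpper U) (hQ : ∀ i j, ‖Q i j‖ ≤ 1) (hP : ∀ i j, ‖P i j‖ ≤ 1)
    (hUR : U * (ubarMat p x y).submatrix (fun t => sumEquiv (2 * n) (Sum.inr t)) id =
      diagonal b * Q) (hQP : Q * P = 1) {C B : ℝ} (hC : 1 ≤ C)
    (hB : B = ((C ^ (2 * n)) ^ (n + 1)) ^ (n + 1))
    (hb : ∀ i j : Fin (2 * n), (j : ℕ) = i + 1 → ‖b i‖ ≤ C * ‖b j‖) :
    (∀ i j, ‖x i j‖ ≤ B ^ (2 * n) * B) ∧ ∀ i j, ‖y i j‖ ≤ B ^ (2 * n) * B := by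
  set z := blk p (wa p n * xᵀ * wa p n) y 0 x with hz
  have hUz : ∀ i j, (U * z) i j = b i * Q i (sumEquiv (2 * n) (Sum.inl j)) := by
    intro i j
    rw [← diagonal_mul, ← hUR, Matrix.mul_apply, Matrix.mul_apply]
    simp [ubarMat_apply_inr_inl, hz]
  have hU1 : ∀ i j, U i j = b i * Q i (sumEquiv (2 * n) (Sum.inr j)) := by
    intro i j
    rw [← diagonal_mul, ← hUR, Matrix.mul_apply]
    simp [ubarMat_apply_inr_inr, Matrix.one_apply]
  have hbQ : ∀ i j, ‖b i * Q i j‖ ≤ ‖b i‖ := fun i j => by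
    rw [norm_mul]
    exact mul_le_of_le_one_right (norm_nonneg _) (hQ i j)
  have hb1 : ∀ i, 1 ≤ ‖b i‖ := fun i => by
    simpa [← hU1, hU.2] using hbQ i (sumEquiv (2 * n) (Sum.inr i))
  have hB1 : 1 ≤ B := hB ▸ one_le_pow₀ (one_le_pow₀ (one_le_pow₀ hC))
  let l : Fin n := ⟨n - 1, by omega⟩
  have hprod : ∏ i : Fin n, ‖b (sumEquiv n (Sum.inr i))‖ ≤
      ∏ i : Fin n, if i = l then 1 else ‖b (sumEquiv n (Sum.inl i))‖ := by
    let τ := (Equiv.sumCongr (sumEquiv n) (sumEquiv n)).trans (sumEquiv (2 * n))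
    refine prod_norm_inr_le_prod_norm_inl (u := U.submatrix (sumEquiv n) (sumEquiv n))
      (b := b ∘ sumEquiv n) (Q := Q.submatrix (sumEquiv n) τ) (P := P.submatrix τ (sumEquiv n))
      (w := wa p n) (x := x) (y := y) l
      (wa_mul_wa p n) (norm_wa_apply_le p n) rfl ?_ ?_ ?_ ?_ ?_ (fun _ _ => hQ _ _)
      (fun _ _ => hP _ _) ?_ ?_
    · intro j
      rw [wa_mul_mul_wa_apply, transpose_apply]
      exact hx _ _ (by simp [l]; omega)
    · intro j
      rcases eq_or_ne l j with h | h
      · rw [← h, Matrix.one_apply_eq]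
        exact hU.2 _
      · rw [Matrix.one_apply_ne h]
        refine hU.1 _ _ ?_
        have : (l : ℕ) ≠ j := fun h' => h (Fin.ext h')
        have hl : (l : ℕ) = n - 1 := rfl
        rw [sumEquiv_inl_val, sumEquiv_inl_val]
        omega
    · ext i j
      exact hU.1 _ _ (by simp; omega)
    · exact IsUnipUpper.det_eq_one ⟨fun i j hij => hU.1 _ _ (by simpa using hij), fun i => hU.2 _⟩
    · exact IsUnipUpper.det_eq_one ⟨fun i j hij => hU.1 _ _ (by simpa using hij), fun i => hU.2 _⟩
    · have hR : fromCols (fromBlocks (wa p n * xᵀ * wa p n) y 0 x) 1 =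
          ((ubarMat p x y).submatrix (fun t => sumEquiv (2 * n) (Sum.inr t)) id).submatrix
            (sumEquiv n) τ := by
        ext i j
        rcases j with j | j
        · simp [τ, ubarMat_apply_inr_inl, blk]
        · simp [τ, ubarMat_apply_inr_inr, Matrix.one_apply]
      rw [hR, submatrix_mul_equiv, hUR]
      ext i j
      simp [diagonal_mul]
    · rw [submatrix_mul_equiv, hQP, submatrix_one_equiv]
  have hbB : ∀ i, ‖b i‖ ≤ B := by
    have h := le_of_prod_le_prod_ite l (one_le_pow₀ hC : 1 ≤ C ^ (2 * n))
      (fun i => hb1 (sumEquiv n (Sum.inl i))) (fun i => hb1 (sumEquiv n (Sum.inr i)))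
      (fun i j => norm_le_pow_mul_norm hC hb _ _ (by rw [Fin.le_def]; simp; omega)) hprod
    rw [Fintype.card_fin, ← hB] at h
    intro i
    obtain ⟨i | i, rfl⟩ := (sumEquiv n).surjective i
    · exact (h i).1
    · exact (h i).2
  have hzU : z = U.adjugate * (U * z) := by
    rw [← Matrix.mul_assoc, adjugate_mul, hU.det_eq_one, one_smul, Matrix.one_mul]
  have hzB : ∀ i j, ‖z i j‖ ≤ B ^ (2 * n) * B := by
    intro i j
    rw [hzU]
    refine norm_mul_apply_le (by positivity) (by positivity) (fun k => ?_) fun k => ?_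
    · have := norm_adjugate_apply_le U hB1 (fun i j => hU1 i j ▸ (hbQ i _).trans (hbB i)) i k
      rwa [Fintype.card_fin] at this
    · rw [hUz]
      exact (hbQ k _).trans (hbB k)
  refine ⟨fun i j => ?_, fun i j => ?_⟩
  · simpa [hz, blk] using hzB (sumEquiv n (Sum.inr i)) (sumEquiv n (Sum.inr j))
  · simpa [hz, blk] using hzB (sumEquiv n (Sum.inl i)) (sumEquiv n (Sum.inr j))

lemma norm_iwasawa_le_mul_norm_of_ne_zero {p : ℕ} [Fact p.Prime] {n : ℕ} {ψ : ℚ_[p] → ℂˣ}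
    {a₀ : ℚ_[p]} (ha₀ : ψ a₀ ≠ 1) {K₀ : Set (GL (Fin (2 * (2 * n))) ℚ_[p])} {ε : ℝ} (hε : 0 < ε)
    (hK₀ : ∀ g ∈ SpSet p n,
      (∀ a c, ‖((g : Matrix (Fin (2 * (2 * n))) (Fin (2 * (2 * n))) ℚ_[p]) - 1) a c‖ ≤ ε) →
        g ∈ K₀)
    {W : GL (Fin (2 * (2 * n))) ℚ_[p] → ℂ}
    (hWN : ∀ v g : GL (Fin (2 * (2 * n))) ℚ_[p], v ∈ SpSet p n → g ∈ SpSet p n →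
      IsUnipUpper (v : Matrix (Fin (2 * (2 * n))) (Fin (2 * (2 * n))) ℚ_[p]) →
      W (v * g) = (ψ (sdSumUpTo (2 * (2 * n)) (2 * n - 1)
        (v : Matrix (Fin (2 * (2 * n))) (Fin (2 * (2 * n))) ℚ_[p])) : ℂ) * W g)
    (hWK : ∀ g ∈ SpSet p n, ∀ k ∈ K₀, W (g * k) = W g)
    {u : GL (Fin (2 * (2 * n))) ℚ_[p]} (hu : u ∈ SpSet p n) (hWu : W u ≠ 0)
    {U : Matrix (Fin (2 * n)) (Fin (2 * n)) ℚ_[p]} {b : Fin (2 * n) → ℚ_[p]}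
    {Q : Matrix (Fin (2 * n)) (Fin (2 * (2 * n))) ℚ_[p]}
    {P : Matrix (Fin (2 * (2 * n))) (Fin (2 * n)) ℚ_[p]}
    (hU : IsUnipUpper U) (hb : ∀ i, b i ≠ 0) (hQ : ∀ i j, ‖Q i j‖ ≤ 1) (hP : ∀ i j, ‖P i j‖ ≤ 1)
    (hUR : U * (u : Matrix (Fin (2 * (2 * n))) (Fin (2 * (2 * n))) ℚ_[p]).submatrix
      (fun t => sumEquiv (2 * n) (Sum.inr t)) id = diagonal b * Q)
    (hQP : Q * P = 1) {i j : Fin (2 * n)} (hij : (j : ℕ) = i + 1) :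
    ‖b i‖ ≤ max 1 (‖a₀‖ / ε) * ‖b j‖ := by
  by_contra! hlt
  obtain ⟨v, k, hv, hk, hvk, hvU, hvs, hkn⟩ :=
    exists_isUnipUpper_mul_eq_mul rfl hu hU hb hQ hP hUR hQP hij (-a₀)
  obtain ⟨v', hv', rfl⟩ := exists_mem_SpSet_coe_eq hv
  obtain ⟨k', hk', rfl⟩ := exists_mem_SpSet_coe_eq hk
  have hbi : 0 < ‖b i‖ := norm_pos_iff.2 (hb i)
  have hkK : k' ∈ K₀ := by
    refine hK₀ k' hk' fun a c => (hkn a c).trans ?_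
    rw [norm_neg, ← mul_div_assoc, div_le_iff₀ hbi, ← div_le_iff₀' hε, mul_div_right_comm]
    exact (mul_le_mul_of_nonneg_right (le_max_right 1 _) (norm_nonneg _)).trans hlt.le
  have h := hWN v' u hv' hu hvU
  rw [show v' * u = u * k' from Units.ext hvk, hWK u hu k' hkK, hvs, neg_neg] at h
  exact ha₀ (Units.ext (mul_right_cancel₀ hWu (by rw [← h, Units.val_one, one_mul])))

/-- **Lemma 4.1.**  For every compact open subgroup `K₀` of `G` there is a compact subset
`Ω ⊆ Ū_♦` such that every continuous `(N, ψ_N)`-equivariant, right-`K₀`-invariant function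
`W : G → ℂ` has its support on `Ū_♦` contained in `Ω`. -/
theorem lemma_4_1
    (p : ℕ) [Fact p.Prime] (n : ℕ) (hn : 1 ≤ n)
    (ψ : ℚ_[p] → ℂˣ)
    (hψ_add : ∀ a b : ℚ_[p], ψ (a + b) = ψ a * ψ b)
    (hψ_cont : Continuous ψ)
    (hψ_ne : ∃ a : ℚ_[p], ψ a ≠ 1)
    (K₀ : Subgroup (GL (Fin (2 * (2 * n))) ℚ_[p]))
    (hK₀_sub : (K₀ : Set (GL (Fin (2 * (2 * n))) ℚ_[p])) ⊆ SpSet p n)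
    (hK₀_cpt : IsCompact (K₀ : Set (GL (Fin (2 * (2 * n))) ℚ_[p])))
    (hK₀_open : ∃ V : Set (GL (Fin (2 * (2 * n))) ℚ_[p]),
      IsOpen V ∧ (K₀ : Set (GL (Fin (2 * (2 * n))) ℚ_[p])) = V ∩ SpSet p n) :
    ∃ Ω : Set (GL (Fin (2 * (2 * n))) ℚ_[p]), IsCompact Ω ∧ Ω ⊆ UbarSet p n ∧
      ∀ W : GL (Fin (2 * (2 * n))) ℚ_[p] → ℂ,
        ContinuousOn W (SpSet p n) →
        (∀ v g : GL (Fin (2 * (2 * n))) ℚ_[p], v ∈ SpSet p n → g ∈ SpSet p n →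
          IsUnipUpper (v : Matrix (Fin (2 * (2 * n))) (Fin (2 * (2 * n))) ℚ_[p]) →
          W (v * g) =
            (ψ (sdSumUpTo (2 * (2 * n)) (2 * n - 1)
              (v : Matrix (Fin (2 * (2 * n))) (Fin (2 * (2 * n))) ℚ_[p])) : ℂ) * W g) →
        (∀ g ∈ SpSet p n, ∀ k ∈ K₀, W (g * k) = W g) →
        {u : GL (Fin (2 * (2 * n))) ℚ_[p] | u ∈ UbarSet p n ∧ W u ≠ 0} ⊆ Ω := by
  obtain ⟨a₀, ha₀⟩ := hψ_ne
  obtain ⟨V, hV, hKV⟩ := hK₀_open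
  have hmem : ∀ g, g ∈ V → g ∈ SpSet p n → g ∈ K₀ := fun g h1 h2 => by
    rw [← SetLike.mem_coe, hKV]
    exact ⟨h1, h2⟩
  have hV1 : (1 : GL (Fin (2 * (2 * n))) ℚ_[p]) ∈ V := by
    have h : (1 : GL (Fin (2 * (2 * n))) ℚ_[p]) ∈
        (K₀ : Set (GL (Fin (2 * (2 * n))) ℚ_[p])) := K₀.one_mem
    rw [hKV] at h
    exact h.1
  obtain ⟨ε, hε, hεV⟩ := exists_pos_forall_norm_sub_one_le_mem hV hV1
  obtain ⟨B, hB⟩ : ∃ B, B = ((max 1 (‖a₀‖ / ε) ^ (2 * n)) ^ (n + 1)) ^ (n + 1) := ⟨_, rfl⟩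
  refine ⟨_, isCompact_setOf_ubarMat_norm_le (B ^ (2 * n) * B), ?_, ?_⟩
  · rintro u ⟨x, y, h, -⟩
    exact ⟨x, y, h⟩
  rintro W - hWN hWK u ⟨huU, hWu⟩
  have huS := UbarSet_subset_SpSet huU
  obtain ⟨x, y, hx, hy, hu⟩ := huU
  refine ⟨x, y, ⟨hx, hy, hu⟩, ?_⟩
  obtain ⟨U, b, Q, P, hU, hb, hQ, hP, hUR, hQP⟩ := exists_iwasawa
    ((ubarMat p x y).submatrix (fun t => sumEquiv (2 * n) (Sum.inr t)) id)
    ((1 : Matrix _ _ ℚ_[p]).submatrix id fun t => sumEquiv (2 * n) (Sum.inr t)) (by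
      ext i j
      simp [Matrix.mul_apply, Matrix.one_apply, ubarMat_apply_inr_inr])
  refine norm_apply_le_of_isUnipUpper_mul_eq hn hx hU hQ hP hUR hQP (le_max_left _ _) hB
    fun i j hij => ?_
  rw [← hu] at hUR
  exact norm_iwasawa_le_mul_norm_of_ne_zero ha₀ hε (fun g hg hgε => hmem g (hεV g hg hgε) hg)
    hWN hWK huS hWu hU hb hQ hP hUR hQP hij
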